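/- arXiv:1206.6731 — 2 statements merged into one kernel-verified Lean document; each statement's English description precedes it below -/
import Mathlib

section
/- If m ∈ G(I^k) and s ∈ set(m), then there exist a monomial w ∈ G(I^k) with w <_revlex m and an index t with 1 ≤ t < s such that x_t divides m and x_s·m = x_t·w. -/
open MvPolynomial Finset

/-- A monomial in `n` variables, recorded by its exponent vector
(index `i : Fin n` corresponds to the variable `x_{i+1}` of the paper). -/
abbrev Mon (n : ℕ) := Fin n →₀ ℕ

/-- The exponent vector of the single variable `x_{j+1}` (`0`-indexed `j`). -/
noncomputable def sing (n j : ℕ) : Mon n :=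
  Finsupp.onFinset Finset.univ (fun i => if (i : ℕ) = j then 1 else 0)
    (fun a _ => Finset.mem_univ a)

/-- Total degree of a monomial. -/
def deg {n : ℕ} (m : Mon n) : ℕ := m.sum fun _ e => e

/-- `m₁ <_lex m₂` for the lexicographic order with `x_1 > x_2 > ⋯ > x_n`. -/
def lexLT {n : ℕ} (m₁ m₂ : Mon n) : Prop :=
  ∃ i : Fin n, (∀ j : Fin n, j < i → m₁ j = m₂ j) ∧ m₁ i < m₂ i

def lexLE {n : ℕ} (m₁ m₂ : Mon n) : Prop := m₁ = m₂ ∨ lexLT m₁ m₂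

/-- `m₁ <_revlex m₂` : the increasing reverse lexicographic order. -/
def revLT {n : ℕ} (m₁ m₂ : Mon n) : Prop :=
  ∃ s : Fin n, (∀ i : Fin n, s < i → m₁ i = m₂ i) ∧ m₂ s < m₁ s

def revLE {n : ℕ} (m₁ m₂ : Mon n) : Prop := m₁ = m₂ ∨ revLT m₁ m₂

/-- `min(m)`: the (0-indexed) smallest index in the support of `m`. -/
noncomputable def minIdx {n : ℕ} (m : Mon n) : ℕ := sInf {j : ℕ | ∃ h : j < n, m ⟨j, h⟩ ≠ 0}

/-- `m̄`: the part of `m` supported in the variables `x_1, …, x_l`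
(0-indexed: indices `< l`). -/
noncomputable def lowPart {n : ℕ} (l : ℕ) (m : Mon n) : Mon n :=
  m.filter fun i => (i : ℕ) < l

/-- `m̃`: the part of `m` supported in the variables `x_{l+1}, …, x_n`
(0-indexed: indices `≥ l`). -/
noncomputable def highPart {n : ℕ} (l : ℕ) (m : Mon n) : Mon n :=
  m.filter fun i => l ≤ (i : ℕ)

/-- The exponent vector of `u = x_1 · x_{l+1}^{a_{l+1}} ⋯ x_n^{a_n}`, where
`a j` (for `l ≤ j < n`, 0-indexed) is the exponent of `x_{j+1}`. -/
noncomputable def uVec (n l : ℕ) (a : ℕ → ℕ) : Mon n :=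
  sing n 0 + ∑ j ∈ Finset.Ico l n, a j • sing n j

/-- The exponent vector of `v = x_l · x_n^{d-1}`. -/
noncomputable def vVec (n l d : ℕ) : Mon n :=
  sing n (l - 1) + (d - 1) • sing n (n - 1)

/-- The lexsegment `L(u,v)`: monomials `w` of degree `d` with `u ≥_lex w ≥_lex v`. -/
def lexSeg (n l d : ℕ) (a : ℕ → ℕ) : Set (Mon n) :=
  { w | deg w = d ∧ lexLE (vVec n l d) w ∧ lexLE w (uVec n l a) }

/-- The lexsegment ideal `I = (L(u,v)) ⊆ K[x_1,…,x_n]`. -/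
noncomputable def lexIdeal (n l d : ℕ) (a : ℕ → ℕ) (K : Type*) [Field K] :
    Ideal (MvPolynomial (Fin n) K) :=
  Ideal.span ((fun w => monomial w (1 : K)) '' lexSeg n l d a)

/-- `G(J)`: the minimal monomial generators of a monomial ideal `J`, i.e.
monomials `m ∈ J` with `m / x_i ∉ J` for every `i ∈ supp m`. -/
def minGens {n : ℕ} (K : Type*) [Field K] (J : Ideal (MvPolynomial (Fin n) K)) :
    Set (Mon n) :=
  { m | monomial m (1 : K) ∈ J ∧
      ∀ i ∈ m.support, monomial (m - Finsupp.single i 1) (1 : K) ∉ J }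

/-- `J_{<revlex m}`: the ideal generated by all `z ∈ G(J)` with `z <_revlex m`. -/
noncomputable def idealBelow {n : ℕ} (K : Type*) [Field K]
    (J : Ideal (MvPolynomial (Fin n) K)) (m : Mon n) : Ideal (MvPolynomial (Fin n) K) :=
  Ideal.span ((fun z => monomial z (1 : K)) '' { z | z ∈ minGens K J ∧ revLT z m })

/-- `set(m) = {j : x_j · m ∈ J_{<revlex m}}` (0-indexed). -/
def setOfGen {n : ℕ} (K : Type*) [Field K] (J : Ideal (MvPolynomial (Fin n) K))
    (m : Mon n) : Set ℕ :=
  { j | j < n ∧ monomial (m + sing n j) (1 : K) ∈ idealBelow K J m }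

/-- The order `≺` on monomials: compare first the degree of the part supported in
`x_1,…,x_l`, then `<_lex`. -/
def precLT {n : ℕ} (l : ℕ) (m₁ m₂ : Mon n) : Prop :=
  deg (lowPart l m₁) < deg (lowPart l m₂) ∨
    (deg (lowPart l m₁) = deg (lowPart l m₂) ∧ lexLT m₁ m₂)

/-- `w = g(z)`: `w` is the `<_revlex`-smallest minimal monomial generator of `J`
dividing the monomial `z` (the value of the decomposition function). -/
def isDecompOf {n : ℕ} (K : Type*) [Field K] (J : Ideal (MvPolynomial (Fin n) K))
    (z w : Mon n) : Prop :=
  w ∈ minGens K J ∧ w ≤ z ∧ ∀ w' ∈ minGens K J, w' ≤ z → revLE w w'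

theorem deg_eq_aux {n : ℕ} (m : Mon n) : deg m = ∑ i, m i := by
  unfold deg
  exact Finsupp.sum_fintype _ _ (fun _ => rfl)

theorem deg_add_aux {n : ℕ} (m m' : Mon n) : deg (m + m') = deg m + deg m' := by
  simp [deg_eq_aux, Finset.sum_add_distrib]

theorem mem_span_aux {n : ℕ} (K : Type*) [Field K] (T : Set (Mon n)) (m : Mon n) :
    monomial m (1 : K) ∈ Ideal.span ((fun z => monomial z (1 : K)) '' T) ↔
      ∃ z ∈ T, z ≤ m := by
  classical
  rw [MvPolynomial.mem_ideal_span_monomial_image]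
  simp [MvPolynomial.support_monomial]

theorem eq_of_le_deg_aux {n : ℕ} {m m' : Mon n} (h : m ≤ m') (hd : deg m' ≤ deg m) :
    m = m' := by
  obtain ⟨c, rfl⟩ := exists_add_of_le h
  rw [deg_add_aux] at hd
  have h0 : deg c = 0 := by omega
  rw [deg_eq_aux, Finset.sum_eq_zero_iff] at h0
  have : c = 0 := by
    ext i
    simpa using h0 i (Finset.mem_univ i)
  simp [this]

/-- Powers of the lexsegment ideal are generated by monomials of one degree. -/
theorem pow_span_aux (n l d : ℕ) (a : ℕ → ℕ) (K : Type*) [Field K] (k : ℕ) :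
    ∃ T : Set (Mon n), (lexIdeal n l d a K) ^ k =
      Ideal.span ((fun z => monomial z (1 : K)) '' T) ∧ ∀ z ∈ T, deg z = d * k := by
  induction k with
  | zero =>
    refine ⟨{0}, ?_, ?_⟩
    · simp [Ideal.one_eq_top]
    · simp [deg_eq_aux]
  | succ k ih =>
    obtain ⟨T, hT, hdeg⟩ := ih
    refine ⟨{z | ∃ x ∈ T, ∃ y ∈ lexSeg n l d a, x + y = z}, ?_, ?_⟩
    · rw [pow_succ, hT, lexIdeal, Ideal.span_mul_span']
      congr 1
      ext p
      simp only [Set.mem_mul, Set.mem_image, Set.mem_ofPred_eq]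
      constructor
      · rintro ⟨_, ⟨x, hx, rfl⟩, _, ⟨y, hy, rfl⟩, rfl⟩
        exact ⟨x + y, ⟨x, hx, y, hy, rfl⟩, by simp [MvPolynomial.monomial_mul]⟩
      · rintro ⟨_, ⟨x, hx, y, hy, rfl⟩, rfl⟩
        exact ⟨_, ⟨x, hx, rfl⟩, _, ⟨y, hy, rfl⟩, by simp [MvPolynomial.monomial_mul]⟩
    · rintro _ ⟨x, hx, y, hy, rfl⟩
      rw [deg_add_aux, hdeg x hx, hy.1]
      ring

theorem minGens_deg_aux (n l d : ℕ) (a : ℕ → ℕ) (K : Type*) [Field K] (k : ℕ) (m : Mon n)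
    (hm : m ∈ minGens K ((lexIdeal n l d a K) ^ k)) : deg m = d * k := by
  obtain ⟨T, hT, hdeg⟩ := pow_span_aux n l d a K k
  obtain ⟨h1, h2⟩ := hm
  rw [hT, mem_span_aux] at h1
  obtain ⟨z, hz, hzm⟩ := h1
  by_cases hne : z = m
  · rw [← hne]
    exact hdeg z hz
  · exfalso
    have : ∃ i, z i ≠ m i := by
      by_contra hcon
      push Not at hcon
      exact hne (Finsupp.ext hcon)
    obtain ⟨i, hi⟩ := this
    have hlt : z i < m i := lt_of_le_of_ne (hzm i) hi
    apply h2 i (by simp; omega)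
    rw [hT, mem_span_aux]
    refine ⟨z, hz, fun j => ?_⟩
    by_cases hij : i = j
    · subst hij
      simp
      omega
    · simpa [Finsupp.single_apply, hij] using hzm j

theorem deg_one_aux {n : ℕ} (c : Mon n) (h : deg c = 1) : ∃ t : Fin n, c = sing n t := by
  rw [deg_eq_aux] at h
  have : ∃ t, c t ≠ 0 := by
    by_contra hcon
    push Not at hcon
    simp [hcon] at h
  obtain ⟨t, ht⟩ := this
  refine ⟨t, ?_⟩
  symm
  have hdt : deg (sing n t) = 1 := by
    simp [deg_eq_aux, sing, Fin.val_inj]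
  apply eq_of_le_deg_aux
  · intro i
    simp only [sing, Finsupp.onFinset_apply, Fin.val_inj]
    split_ifs with hi
    · subst hi
      omega
    · omega
  · rw [hdt, deg_eq_aux, h]

/-- If `m ∈ G(I^k)` and `s ∈ set(m)`, then there are `w ∈ G(I^k)` with
`w <_revlex m` and an index `t < s` with `x_t ∣ m` and `x_s·m = x_t·w`. -/
theorem stmt1 (n d l k : ℕ) (K : Type*) [Field K] (a : ℕ → ℕ)
    (hd : 2 ≤ d) (hl2 : 2 ≤ l) (hln : l ≤ n - 1)
    (hsum : ∑ j ∈ Finset.Ico l n, a j = d - 1) (hk : 1 ≤ k) :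
    ∀ m ∈ minGens K ((lexIdeal n l d a K) ^ k),
      ∀ s ∈ setOfGen K ((lexIdeal n l d a K) ^ k) m,
        ∃ w ∈ minGens K ((lexIdeal n l d a K) ^ k), revLT w m ∧
          ∃ t : ℕ, t < s ∧ t < n ∧ sing n t ≤ m ∧ m + sing n s = w + sing n t := by
  intro m hm s hs
  obtain ⟨hsn, hs⟩ := hs
  rw [idealBelow, mem_span_aux] at hs
  obtain ⟨w, ⟨hw, hlt⟩, hle⟩ := hs
  have hdm := minGens_deg_aux n l d a K k m hm
  have hdw := minGens_deg_aux n l d a K k w hw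
  obtain ⟨c, hc⟩ := exists_add_of_le hle
  have hds : deg (sing n s) = 1 := by
    have : ∀ i : Fin n, (i : ℕ) = s ↔ i = ⟨s, hsn⟩ := fun i => by rw [Fin.ext_iff]
    simp [deg_eq_aux, sing, this]
  have hdc : deg c = 1 := by
    have := congrArg deg hc
    rw [deg_add_aux, deg_add_aux] at this
    omega
  obtain ⟨t, rfl⟩ := deg_one_aux c hdc
  have hval : ∀ i : Fin n, m i + (if (i : ℕ) = s then 1 else 0) =
      w i + (if (i : ℕ) = t then 1 else 0) := by
    intro i
    have := DFunLike.congr_fun hc i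
    simpa [sing] using this
  have hts : (t : ℕ) < s := by
    obtain ⟨r, hr1, hr2⟩ := hlt
    have h1 := hval r
    have h2 := hval t
    have hrs : (r : ℕ) = s := by
      by_contra hne
      rw [if_neg hne] at h1
      omega
    by_contra hcon
    rcases Nat.lt_or_ge r t with h | h
    · have h3 := hr1 t h
      rw [if_neg (by omega), if_pos rfl] at h2
      omega
    · have : r = t := Fin.ext (by omega)
      subst this
      rw [if_pos hrs, if_pos rfl] at h1
      omega
  refine ⟨w, hw, hlt, t, hts, t.2, fun i => ?_, hc⟩
  have h1 := hval i
  simp only [sing, Finsupp.onFinset_apply]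
  split_ifs at h1 ⊢ <;> omega
end

section
/- If m ∈ G(I^k), s ∈ set(m), and x_s·m/x_{min(m)} ≺ v^k, then deg(m̄) = k and s > l, where m̄ is the part of m supported in x_1,…,x_l. -/
open MvPolynomial Finset

/-- Sum of the exponents of `m` over the index set `S`. -/
def wt {n : ℕ} (S : Finset (Fin n)) (m : Mon n) : ℕ := ∑ i ∈ S, m i

lemma wt_add {n : ℕ} (S : Finset (Fin n)) (p q : Mon n) : wt S (p + q) = wt S p + wt S q := by
  simp [wt, Finset.sum_add_distrib]

lemma deg_eq_wt {n : ℕ} (m : Mon n) : deg m = wt Finset.univ m := by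
  simp [deg, wt, Finsupp.sum_fintype]

lemma deg_lowPart {n : ℕ} (l : ℕ) (m : Mon n) :
    deg (lowPart l m) = wt (Finset.univ.filter fun i : Fin n => (i : ℕ) < l) m := by
  rw [deg_eq_wt, wt, wt, Finset.sum_filter]
  simp [lowPart, Finsupp.filter_apply]

/-- The ideal of polynomials all of whose monomials have `S`-weight at least `t`. -/
def wtIdeal {n : ℕ} (K : Type*) [Field K] (S : Finset (Fin n)) (t : ℕ) :
    Ideal (MvPolynomial (Fin n) K) where
  carrier := {p | ∀ m ∈ p.support, t ≤ wt S m}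
  zero_mem' := by simp
  add_mem' := by
    classical
    intro p q hp hq m hm
    rcases Finset.mem_union.1 (MvPolynomial.support_add hm) with h | h
    · exact hp m h
    · exact hq m h
  smul_mem' := by
    classical
    intro c p hp m hm
    obtain ⟨x, hx, y, hy, rfl⟩ := Finset.mem_add.1 (MvPolynomial.support_mul c p hm)
    rw [wt_add]
    exact (hp y hy).trans (Nat.le_add_left _ _)

lemma wtIdeal_mul_le {n : ℕ} (K : Type*) [Field K] (S : Finset (Fin n)) (s t : ℕ) :
    wtIdeal K S s * wtIdeal K S t ≤ wtIdeal K S (s + t) := by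
  classical
  rw [Ideal.mul_le]
  intro p hp q hq m hm
  obtain ⟨x, hx, y, hy, rfl⟩ := Finset.mem_add.1 (MvPolynomial.support_mul p q hm)
  rw [wt_add]
  exact Nat.add_le_add (hp x hx) (hq y hy)

lemma pow_le_wtIdeal {n : ℕ} (K : Type*) [Field K] (S : Finset (Fin n)) (t k : ℕ)
    (I : Ideal (MvPolynomial (Fin n) K)) (hI : I ≤ wtIdeal K S t) :
    I ^ k ≤ wtIdeal K S (k * t) := by
  induction k with
  | zero => intro p _ m _; simp
  | succ k ih =>
    rw [pow_succ, Nat.succ_mul]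
    exact (Ideal.mul_mono ih hI).trans (wtIdeal_mul_le K S _ _)

lemma wt_of_mem_pow {n : ℕ} (K : Type*) [Field K] (S : Finset (Fin n)) (t k : ℕ)
    (G : Set (Mon n)) (hG : ∀ w ∈ G, t ≤ wt S w) (m : Mon n)
    (hm : monomial m (1 : K) ∈ (Ideal.span ((fun w => monomial w (1 : K)) '' G)) ^ k) :
    k * t ≤ wt S m := by
  classical
  have hI : Ideal.span ((fun w => monomial w (1 : K)) '' G) ≤ wtIdeal K S t := by
    rw [Ideal.span_le]
    rintro _ ⟨w, hw, rfl⟩ x hx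
    have := MvPolynomial.support_monomial_subset hx
    rw [Finset.mem_singleton.1 this]
    exact hG w hw
  exact pow_le_wtIdeal K S t k _ hI hm m (by simp [MvPolynomial.mem_support_iff])

lemma sing_eq {n j : ℕ} (h : j < n) : sing n j = Finsupp.single ⟨j, h⟩ 1 := by
  ext i
  simp [sing, Finsupp.single_apply, Fin.ext_iff, eq_comm]

lemma wt_sing {n j : ℕ} (S : Finset (Fin n)) (h : j < n) :
    wt S (sing n j) = if (⟨j, h⟩ : Fin n) ∈ S then 1 else 0 := by
  simp [sing_eq h, wt, Finsupp.single_apply]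

lemma low_of_mem_lexSeg {n l d : ℕ} {a : ℕ → ℕ} (hl2 : 2 ≤ l) (hln : l ≤ n - 1)
    (w : Mon n) (hw : w ∈ lexSeg n l d a) :
    1 ≤ wt (Finset.univ.filter fun i : Fin n => (i : ℕ) < l) w := by
  have key : ∃ i : Fin n, (i : ℕ) < l ∧ 1 ≤ w i := by
    have hv : 1 ≤ vVec n l d ⟨l - 1, by omega⟩ := by simp [vVec, sing]
    rcases hw.2.1 with h | ⟨i, h1, h2⟩
    · exact ⟨⟨l - 1, by omega⟩, by simp; omega, h ▸ hv⟩
    · by_cases hi : (i : ℕ) < l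
      · exact ⟨i, hi, by omega⟩
      · refine ⟨⟨l - 1, by omega⟩, by simp; omega, ?_⟩
        rw [← h1 _ (by simp [Fin.lt_def]; omega)]
        exact hv
  obtain ⟨i, hi, hw1⟩ := key
  exact hw1.trans (Finset.single_le_sum (f := fun j => w j) (fun _ _ => Nat.zero_le _)
    (by simp [hi]))

lemma not_lexLT {n l d k : ℕ} (hl2 : 2 ≤ l) (hln : l ≤ n - 1) (hd : 2 ≤ d) (m : Mon n)
    (hlow : k ≤ wt (Finset.univ.filter fun i : Fin n => (i : ℕ) < l) m)
    (hdeg : k * d ≤ wt Finset.univ m) : ¬ lexLT m (k • vVec n l d) := by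
  rintro ⟨i, h1, h2⟩
  have hln' : l < n := by omega
  have hl' : l - 1 < n := by omega
  have hn' : n - 1 < n := by omega
  have hv : ∀ j : Fin n, (k • vVec n l d) j =
      k * ((if (j : ℕ) = l - 1 then 1 else 0) + (d - 1) * (if (j : ℕ) = n - 1 then 1 else 0)) := by
    intro j; simp [vVec, sing, mul_add]
  have hile : (i : ℕ) = l - 1 ∨ (i : ℕ) = n - 1 := by
    by_contra hc
    push Not at hc
    rw [hv, if_neg hc.1, if_neg hc.2] at h2
    simp at h2
  have hlowv : wt (Finset.univ.filter fun i : Fin n => (i : ℕ) < l) (k • vVec n l d) = k := by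
    rw [wt, Finset.sum_eq_single (⟨l - 1, hl'⟩ : Fin n)]
    · rw [hv, if_pos rfl, if_neg (show ¬ (l - 1 = n - 1) by omega)]; simp
    · intro j hj hne
      have hj' : (j : ℕ) < l := by simpa using hj
      have : (j : ℕ) ≠ l - 1 := fun h => hne (Fin.ext h)
      rw [hv, if_neg this, if_neg (by omega)]
      simp
    · intro h; exact absurd (by simp; omega) h
  have hdegv : wt Finset.univ (k • vVec n l d) = k * d := by
    have h : ∀ q : Mon n, wt Finset.univ (k • q) = k * wt Finset.univ q := by
      intro q; simp [wt, Finset.mul_sum]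
    have h' : ∀ q : Mon n, wt Finset.univ ((d - 1) • q) = (d - 1) * wt Finset.univ q := by
      intro q; simp [wt, Finset.mul_sum]
    rw [h, vVec, wt_add, h', wt_sing _ hl', wt_sing _ hn']
    simp
    left; omega
  rcases hile with hi | hi
  · have : wt (Finset.univ.filter fun i : Fin n => (i : ℕ) < l) m
        < wt (Finset.univ.filter fun i : Fin n => (i : ℕ) < l) (k • vVec n l d) := by
      refine Finset.sum_lt_sum (fun j hj => ?_) ⟨i, by simp; omega, h2⟩
      have hj' : (j : ℕ) < l := by simpa using hj
      by_cases hji : j = i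
      · rw [hji]; exact h2.le
      · have : (j : ℕ) ≠ i := fun h => hji (Fin.ext h)
        exact (h1 j (by rw [Fin.lt_def]; omega)).le
    omega
  · have : wt Finset.univ m < wt Finset.univ (k • vVec n l d) := by
      refine Finset.sum_lt_sum (fun j hj => ?_) ⟨i, by simp, h2⟩
      by_cases hji : j = i
      · rw [hji]; exact h2.le
      · have : (j : ℕ) ≠ i := fun h => hji (Fin.ext h)
        exact (h1 j (by rw [Fin.lt_def]; omega)).le
    omega

/-- If `m ∈ G(I^k)`, `s ∈ set(m)` and `x_s·m/x_{min(m)} ≺ v^k`, then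
`deg m̄ = k` and `s > l` (0-indexed: `s ≥ l`). -/
theorem stmt6 (n d l k : ℕ) (K : Type*) [Field K] (a : ℕ → ℕ)
    (hd : 2 ≤ d) (hl2 : 2 ≤ l) (hln : l ≤ n - 1)
    (hsum : ∑ j ∈ Finset.Ico l n, a j = d - 1) (hk : 1 ≤ k) :
    ∀ m ∈ minGens K ((lexIdeal n l d a K) ^ k),
      ∀ s ∈ setOfGen K ((lexIdeal n l d a K) ^ k) m,
        precLT l (m + sing n s - sing n (minIdx m)) (k • vVec n l d) →
          deg (lowPart l m) = k ∧ l ≤ s := by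
  intro m hm s hs hprec
  have hsn : s < n := hs.1
  have hln' : l < n := by omega
  set L : Finset (Fin n) := Finset.univ.filter fun i : Fin n => (i : ℕ) < l with hL
  have hlow : k ≤ wt L m := by
    have := wt_of_mem_pow K L 1 k _ (fun w hw => low_of_mem_lexSeg (a := a) (d := d) hl2 hln w hw)
      m hm.1
    omega
  have hdeg : k * d ≤ wt Finset.univ m :=
    wt_of_mem_pow K Finset.univ d k _ (fun w (hw : w ∈ lexSeg n l d a) =>
      by rw [← deg_eq_wt, hw.1]) m hm.1
  -- the minimal index
  have hex : ∃ i ∈ L, m i ≠ 0 := by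
    by_contra hc
    push Not at hc
    have : wt L m = 0 := Finset.sum_eq_zero hc
    omega
  obtain ⟨i, hiL, hi⟩ := hex
  have hil : (i : ℕ) < l := by simpa [hL] using hiL
  have hmem : (i : ℕ) ∈ {j : ℕ | ∃ h : j < n, m ⟨j, h⟩ ≠ 0} := ⟨i.2, hi⟩
  have hminl : minIdx m < l := lt_of_le_of_lt (Nat.sInf_le hmem) hil
  obtain ⟨hmn, hm0⟩ : ∃ h : minIdx m < n, m ⟨minIdx m, h⟩ ≠ 0 := Nat.sInf_mem ⟨_, hmem⟩
  set m' := m + sing n s - sing n (minIdx m) with hm'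
  have hadd : m' + sing n (minIdx m) = m + sing n s := by
    apply tsub_add_cancel_of_le
    refine le_trans ?_ (le_self_add)
    rw [sing_eq hmn, Finsupp.single_le_iff]
    omega
  have hLs : wt L (sing n s) = if s < l then 1 else 0 := by
    rw [wt_sing _ hsn]; simp [hL]
  have hLm : wt L (sing n (minIdx m)) = 1 := by
    rw [wt_sing _ hmn]; simp [hL, hminl]
  have e1 : wt L m' + 1 = wt L m + if s < l then 1 else 0 := by
    rw [← hLs, ← hLm, ← wt_add, ← wt_add, hadd]
  have e2 : wt Finset.univ m' = wt Finset.univ m := by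
    have h := congrArg (wt Finset.univ) hadd
    rw [wt_add, wt_add, wt_sing _ hsn, wt_sing _ hmn] at h
    simpa using h
  have hlt : wt L m' < k := by
    by_contra hge
    push Not at hge
    have hno := not_lexLT (d := d) hl2 hln hd m' hge (by omega)
    have hvk : wt L (k • vVec n l d) = k := by
      have h : ∀ (c : ℕ) (q : Mon n), wt L (c • q) = c * wt L q := by
        intro c q; simp [wt, Finset.mul_sum]
      rw [h, vVec, wt_add, h, wt_sing _ (show l - 1 < n by omega),
        wt_sing _ (show n - 1 < n by omega), if_pos (by simp [hL]; omega),
        if_neg (by simp [hL]; omega)]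
      simp
    rcases hprec with h | h
    · rw [deg_lowPart, deg_lowPart] at h
      have h' : wt L m' < wt L (k • vVec n l d) := h
      omega
    · exact hno h.2
  rw [deg_lowPart]
  change wt L m = k ∧ l ≤ s
  split_ifs at e1 <;> omega
end
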